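/- arXiv:1704.08365 — 2 statements merged into one kernel-verified Lean document; each statement's English description precedes it below -/
import Mathlib

section
/- Let R be a nontrivial commutative indecomposable ring and P a set such that there exists a local automorphism of Π = ∏_{x∈P} R which is not an R-algebra automorphism of Π. Then there exists a non-principal ultrafilter on P which is closed under intersections of any family of at most |R| of its members. -/
universe u v

/-- An ultrafilter `U` on `P` is closed under intersections of any family of at most `|R|`
of its members. -/
def UFClosedUnderInter (R : Type u) {P : Type v} (U : Ultrafilter P) : Prop :=
  ∀ S : Set (Set P),
    Cardinal.lift.{u} (Cardinal.mk ↥S) ≤ Cardinal.lift.{v} (Cardinal.mk R) →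
      (∀ X ∈ S, X ∈ U) → ⋂₀ S ∈ U


section Helpers
open Classical

noncomputable def indF (R : Type u) [CommRing R] {P : Type v} (X : Set P) : P → R :=
  fun x => if x ∈ X then 1 else 0

theorem aut_single {R : Type u} [CommRing R] [Nontrivial R]
    (hR : ∀ r : R, IsIdempotentElem r → r = 0 ∨ r = 1) {P : Type v}
    (φ : (P → R) ≃ₐ[R] (P → R)) (q : P) :
    ∃ p, φ (Pi.single q 1) = Pi.single p 1 := by
  have hne : ∀ q : P, (Pi.single q (1 : R) : P → R) ≠ 0 := by
    intro q h
    have := congrFun h q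
    simp at this
  have hid : ∀ q : P, (Pi.single q (1 : R) : P → R) * Pi.single q 1 = Pi.single q 1 := by
    intro q
    rw [← Pi.single_mul]; simp
  have hv : ∀ (ψ : (P → R) ≃ₐ[R] (P → R)) (q x : P),
      ψ (Pi.single q 1) x = 0 ∨ ψ (Pi.single q 1) x = 1 := by
    intro ψ q x
    apply hR
    have := congrArg ψ (hid q)
    rw [map_mul] at this
    exact congrFun this x
  have h0 : ∃ p, φ (Pi.single q 1) p ≠ 0 := by
    by_contra hc
    push Not at hc
    have : φ (Pi.single q 1) = 0 := funext hc
    exact hne q ((map_eq_zero_iff φ φ.injective).1 this)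
  obtain ⟨p, hp⟩ := h0
  have hp1 := (hv φ q p).resolve_left hp
  refine ⟨p, ?_⟩
  have e1 : (Pi.single p (1 : R) : P → R) = Pi.single p 1 * φ (Pi.single q 1) := by
    funext x
    by_cases hx : x = p
    · subst hx; simp [hp1]
    · simp [hx]
  have e2 : φ.symm (Pi.single p 1) = φ.symm (Pi.single p 1) * Pi.single q 1 := by
    have := congrArg φ.symm e1
    rw [map_mul, φ.symm_apply_apply] at this
    exact this
  have e3 : φ.symm (Pi.single p 1) = Pi.single q 1 := by
    rcases hv φ.symm p q with h | h
    · exfalso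
      apply hne p
      apply (map_eq_zero_iff φ.symm φ.symm.injective).1
      rw [e2]
      funext x
      by_cases hx : x = q
      · subst hx; simp [h]
      · simp [hx]
    · rw [e2]
      funext x
      by_cases hx : x = q
      · subst hx; simp [h]
      · simp [hx]
  rw [← e3, φ.apply_symm_apply]

theorem aut_range {R : Type u} [CommRing R] [Nontrivial R]
    (hR : ∀ r : R, IsIdempotentElem r → r = 0 ∨ r = 1) {P : Type v}
    (φ : (P → R) ≃ₐ[R] (P → R)) (a : P → R) (p : P) : ∃ x, φ a p = a x := by
  obtain ⟨q, hq⟩ := aut_single hR φ.symm p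
  have hq' : φ (Pi.single q 1) = Pi.single p 1 := by rw [← hq, φ.apply_symm_apply]
  refine ⟨q, ?_⟩
  have e : a * Pi.single q 1 = a q • (Pi.single q (1 : R) : P → R) := by
    funext x
    by_cases hx : x = q
    · subst hx; simp
    · simp [hx]
  have := congrFun (congrArg φ e) p
  rw [map_mul, map_smul, hq'] at this
  simpa using this

theorem functional_uf {R : Type u} [CommRing R] [Nontrivial R] {P : Type v}
    (f : (P → R) →ₗ[R] R) (hf : ∀ a, ∃ x, f a = a x) (r : R) (hr0 : r ≠ 0) (hr1 : r ≠ 1) :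
    ∃ U : Ultrafilter P, ∀ a : P → R, {x | a x = f a} ∈ U := by
  have h01 : ∀ X : Set P, f (indF R X) = 0 ∨ f (indF R X) = 1 := by
    intro X
    obtain ⟨x, hx⟩ := hf (indF R X)
    rw [hx]; unfold indF
    by_cases h : x ∈ X <;> simp [h]
  have hdisj : ∀ X Y : Set P, Disjoint X Y → f (indF R X) = 1 → f (indF R Y) = 1 → False := by
    intro X Y hd hX hY
    obtain ⟨x, hx⟩ := hf (indF R X + r • indF R Y)
    rw [map_add, map_smul, hX, hY] at hx
    have hd' := Set.disjoint_left.1 hd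
    by_cases h1 : x ∈ X
    · have h2 := hd' h1
      simp [indF, h1, h2] at hx
      exact hr0 hx
    · by_cases h2 : x ∈ Y
      · simp [indF, h1, h2] at hx
      · simp [indF, h1, h2] at hx
        obtain ⟨y, hy⟩ := hf (indF R X + indF R Y)
        rw [map_add, hX, hY] at hy
        by_cases h1 : y ∈ X
        · have h2 := hd' h1
          simp [indF, h1, h2] at hy
        · by_cases h2 : y ∈ Y
          · simp [indF, h1, h2] at hy
          · simp [indF, h1, h2] at hy
            apply hr1
            linear_combination hx - hy
  have hsplit : ∀ X Y : Set P, f (indF R X) = f (indF R (X ∩ Y)) + f (indF R (X \ Y)) := by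
    intro X Y
    rw [← map_add]
    congr 1
    funext x
    by_cases h1 : x ∈ X <;> by_cases h2 : x ∈ Y <;> simp [indF, h1, h2]
  have huniv : f (indF R Set.univ) = 1 := by
    obtain ⟨x, hx⟩ := hf (indF R Set.univ)
    rw [hx]; simp [indF]
  let F : Filter P :=
    { sets := {X | f (indF R X) = 1}
      univ_sets := huniv
      sets_of_superset := by
        intro X Y hX hXY
        simp only [Set.mem_ofPred_eq] at *
        rcases h01 (Y \ X) with h | h
        · rw [hsplit Y X, h, Set.inter_eq_self_of_subset_right hXY, hX, add_zero]
        · exact (hdisj X (Y \ X) Set.disjoint_sdiff_right hX h).elim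
      inter_sets := by
        intro X Y hX hY
        simp only [Set.mem_ofPred_eq] at *
        rcases h01 (X ∩ Y) with h | h
        · exfalso
          have h1 := hsplit X Y
          have h2 := hsplit Y X
          rw [Set.inter_comm Y X] at h2
          rw [hX, h, zero_add] at h1
          rw [hY, h, zero_add] at h2
          exact hdisj (X \ Y) (Y \ X) disjoint_sdiff_sdiff h1.symm h2.symm
        · exact h }
  have hF : ∀ X : Set P, X ∈ F ↔ f (indF R X) = 1 := fun X => Iff.rfl
  have hcompl : ∀ X : Set P, f (indF R X) + f (indF R Xᶜ) = 1 := by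
    intro X
    have := hsplit Set.univ X
    rw [huniv, Set.univ_inter, ← Set.compl_eq_univ_sdiff] at this
    exact this.symm
  refine ⟨Ultrafilter.ofComplNotMemIff F ?_, ?_⟩
  · intro X
    rw [hF, hF]
    have := hcompl X
    rcases h01 X with h | h
    · rw [h, zero_add] at this
      simp [h, this]
    · rw [h] at this
      have h3 : f (indF R Xᶜ) = 0 := by linear_combination this
      simp [h, h3]
  · intro a
    change f (indF R {x | a x = f a}) = 1
    rcases h01 {x | a x = f a} with h | h
    · exfalso
      obtain ⟨x, hx⟩ := hf (a - f a • indF R Set.univ + indF R {x | a x = f a})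
      rw [map_add, map_sub, map_smul, huniv, h] at hx
      by_cases h1 : a x = f a
      · simp [indF, h1] at hx
      · simp [indF, h1] at hx
        exact h1 (by linear_combination -hx)
    · exact h

theorem uf_closed {R : Type u} [CommRing R] [Nontrivial R] {P : Type v}
    (U : Ultrafilter P) (hU : ∀ a : P → R, ∃ r, {x | a x = r} ∈ U) :
    UFClosedUnderInter R U := by
  intro S hS hmem
  obtain ⟨i⟩ := Cardinal.lift_mk_le'.1 hS
  by_contra hc
  have hc' := Ultrafilter.compl_mem_iff_notMem.2 hc
  have hex : ∀ x : P, x ∈ (⋂₀ S)ᶜ → ∃ s : S, x ∉ s.1 := by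
    intro x hx
    simpa using hx
  obtain ⟨r, hr⟩ := hU (fun x => if h : x ∈ (⋂₀ S)ᶜ then i (hex x h).choose else 0)
  have h2 := Filter.inter_mem hc' hr
  obtain ⟨y, hy, hyr⟩ := U.nonempty_of_mem h2
  simp only [Set.mem_ofPred_eq, dif_pos hy] at hyr
  have h3 := Filter.inter_mem h2 (hmem _ (hex y hy).choose.2)
  obtain ⟨z, ⟨hz, hzr⟩, hzs⟩ := U.nonempty_of_mem h3
  simp only [Set.mem_ofPred_eq, dif_pos hz] at hzr
  have h4 := i.injective (hyr.trans hzr.symm)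
  rw [h4] at hzs
  exact (hex z hz).choose_spec hzs

theorem comp_aut {R : Type u} [CommRing R] [Nontrivial R] {P : Type v}
    (η : (P → R) →ₗ[R] (P → R)) (τ : P → P) (hτ : Function.Bijective τ)
    (h : ∀ a p, η a p = a (τ p)) : ∃ ψ : (P → R) ≃ₐ[R] (P → R), ⇑ψ = ⇑η := by
  let e := Equiv.ofBijective τ hτ
  refine ⟨AlgEquiv.ofBijective
    ({ toFun := fun a => a ∘ τ, map_one' := rfl, map_mul' := fun _ _ => rfl, map_zero' := rfl,
       map_add' := fun _ _ => rfl, commutes' := fun _ => rfl } : (P → R) →ₐ[R] (P → R)) ⟨?_, ?_⟩, ?_⟩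
  · intro a b hab
    exact hτ.surjective.injective_comp_right hab
  · intro b
    refine ⟨b ∘ e.symm, ?_⟩
    funext x
    change b (e.symm (e x)) = b x
    simp
  · funext a p
    exact (h a p).symm

end Helpers

/-- If `Π = ∏_{x ∈ P} R` admits a local automorphism that is not an
`R`-algebra automorphism, then `P` carries a non-principal ultrafilter closed under
intersections of families of at most `|R|` of its members. -/
theorem stmt11 {R : Type u} [CommRing R] [Nontrivial R]
    (hR : ∀ r : R, IsIdempotentElem r → r = 0 ∨ r = 1)
    {P : Type v}
    (h : ∃ η : (P → R) →ₗ[R] (P → R),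
      (∀ a : P → R, ∃ φ : (P → R) ≃ₐ[R] (P → R), η a = φ a) ∧
      ¬∃ ψ : (P → R) ≃ₐ[R] (P → R), ⇑ψ = ⇑η) :
    ∃ U : Ultrafilter P,
      (¬∃ p : P, ∀ X : Set P, X ∈ U ↔ p ∈ X) ∧ UFClosedUnderInter R U := by
  classical
  obtain ⟨η, hloc, hnot⟩ := h
  have hsing : ∀ q : P, ∃ p, η (Pi.single q 1) = Pi.single p 1 := by
    intro q
    obtain ⟨φ, hφ⟩ := hloc (Pi.single q 1)
    obtain ⟨p, hp⟩ := aut_single hR φ q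
    refine ⟨p, ?_⟩
    rw [hφ]
    convert hp
  by_cases h3 : ∃ r : R, r ≠ 0 ∧ r ≠ 1
  · obtain ⟨r, hr0, hr1⟩ := h3
    have key : ∀ p : P, ∃ U : Ultrafilter P, ∀ a : P → R, {x | a x = η a p} ∈ U := by
      intro p
      refine functional_uf ((LinearMap.proj p).comp η) ?_ r hr0 hr1
      intro a
      obtain ⟨φ, hφ⟩ := hloc a
      change ∃ x, η a p = a x
      rw [hφ]
      exact aut_range hR φ a p
    choose U hU using key
    by_contra hcon
    push Not at hcon
    have hprin : ∀ p : P, ∃ q : P, ∀ X : Set P, X ∈ U p ↔ q ∈ X := by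
      intro p
      by_contra hc
      exact hcon (U p) (by push Not at hc; exact hc) (uf_closed (U p) (fun a => ⟨_, hU p a⟩))
    choose τ hτ using hprin
    have hη : ∀ a p, η a p = a (τ p) := by
      intro a p
      exact ((hτ p _).1 (hU p a)).symm
    refine hnot (comp_aut η τ ⟨?_, ?_⟩ hη)
    · intro x y hxy
      obtain ⟨p, hp⟩ := hsing (τ x)
      have hx := congrFun hp x
      have hy := congrFun hp y
      rw [hη] at hx hy
      rw [← hxy] at hy
      have hx' : x = p := by
        by_contra hne
        simp [hne] at hx
      have hy' : y = p := by
        by_contra hne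
        simp [hne] at hy
      rw [hx', hy']
    · intro q
      obtain ⟨p, hp⟩ := hsing q
      refine ⟨p, ?_⟩
      have hx := congrFun hp p
      rw [hη] at hx
      by_contra hne
      simp [hne] at hx
  · push Not at h3
    rcases finite_or_infinite P with hP | hP
    · exfalso
      have := Fintype.ofFinite P
      choose σ hσ using hsing
      have hinj : Function.Injective σ := by
        intro x y hxy
        obtain ⟨φ, hφ⟩ := hloc (Pi.single x 1 - Pi.single y 1)
        rw [map_sub, hσ, hσ, hxy, sub_self] at hφ
        have h0 := (map_eq_zero_iff φ φ.injective).1 hφ.symm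
        by_contra hne
        have := congrFun h0 x
        simp [hne] at this
      have hbij : Function.Bijective σ := Finite.injective_iff_bijective.1 hinj
      let e := Equiv.ofBijective σ hbij
      refine hnot (comp_aut η e.symm e.symm.bijective ?_)
      intro a p
      obtain ⟨q, rfl⟩ := e.surjective p
      rw [e.symm_apply_apply]
      have ha : a = ∑ x, a x • (Pi.single x (1 : R) : P → R) := by
        funext y
        simp [Finset.sum_apply, Pi.single_apply]
      conv_lhs => rw [ha]
      rw [map_sum]
      simp only [map_smul, hσ, Finset.sum_apply, Pi.smul_apply, Pi.single_apply]
      change ∑ x, a x • (if σ q = σ x then (1 : R) else 0) = a q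
      simp [hinj.eq_iff]
    · have hRfin : Finite R := by
        refine Set.finite_univ_iff.1 (Set.Finite.subset (Set.toFinite {(0 : R), 1}) ?_)
        intro x _
        by_cases hx : x = 0
        · simp [hx]
        · simp [h3 x hx]
      refine ⟨Filter.hyperfilter P, ?_, ?_⟩
      · rintro ⟨p, hp⟩
        exact (Set.finite_singleton p).notMem_hyperfilter ((hp {p}).2 rfl)
      · intro S hS hmem
        obtain ⟨i⟩ := Cardinal.lift_mk_le'.1 hS
        have hfin : Finite S := Finite.of_injective i i.injective
        exact (Filter.sInter_mem (Set.toFinite S)).2 hmem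
end

section
/- Let R be a field and P a set. Then every R-algebra endomorphism of Π = ∏_{x∈P} R (R-linear multiplicative map, not necessarily unital) is induced if and only if there is no non-principal ultrafilter on P closed under intersections of any family of at most |R| of its members. -/
universe u v

/-- A map `η : Π → Π` on `Π = ∏_{x ∈ P} R` is induced if there is a family of pairwise
disjoint subsets `A_x ⊆ P` with `(η a)_y = a_x` for `y ∈ A_x` and `(η a)_y = 0` for
`y ∉ ⋃ A_x`. -/
def InducedEndo {R : Type u} {P : Type v} [Zero R] (η : (P → R) → (P → R)) : Prop :=
  ∃ A : P → Set P, (Pairwise fun x y => Disjoint (A x) (A y)) ∧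
    ∀ a : P → R, (∀ x : P, ∀ y ∈ A x, η a y = a x) ∧
      ∀ y : P, y ∉ (⋃ x : P, A x) → η a y = 0

open Classical in
theorem aux_char {R : Type u} [Field R] {P : Type v} (φ : (P → R) →ₗ[R] R)
    (hm : ∀ a b : P → R, φ (a * b) = φ a * φ b) (h1 : φ 1 = 1) :
    ∃ U : Ultrafilter P, ∀ a : P → R, {q | a q = φ a} ∈ U := by
  have hz : ∀ X : Set P, φ (X.indicator 1) = 0 ∨ φ (X.indicator 1) = 1 := by
    intro X
    have : φ (X.indicator 1) * φ (X.indicator 1) = φ (X.indicator 1) := by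
      rw [← hm]
      congr 1
      ext q
      by_cases hq : q ∈ X <;> simp [hq]
    rcases eq_or_ne (φ (X.indicator 1)) 0 with h | h
    · exact Or.inl h
    · exact Or.inr (mul_left_cancel₀ h (by rw [this, mul_one]))
  have hc : ∀ X : Set P, φ (X.indicator 1) + φ (Xᶜ.indicator 1) = 1 := by
    intro X
    rw [← map_add, Set.indicator_self_add_compl, h1]
  let F : Filter P :=
    { sets := {X | φ (X.indicator 1) = 1}
      univ_sets := by simpa using h1
      sets_of_superset := by
        intro X Y hX hXY
        have : X.indicator (1 : P → R) * Y.indicator 1 = X.indicator 1 := by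
          ext q
          by_cases hq : q ∈ X
          · simp [hq, hXY hq]
          · simp [hq]
        have h2 := hm (X.indicator 1) (Y.indicator 1)
        simp only [Set.mem_ofPred_eq] at hX ⊢
        rw [this, hX, one_mul] at h2
        exact h2.symm
      inter_sets := by
        intro X Y hX hY
        have : X.indicator (1 : P → R) * Y.indicator 1 = (X ∩ Y).indicator 1 := by
          ext q
          by_cases hq : q ∈ X <;> by_cases hq' : q ∈ Y <;> simp [hq, hq']
        have h2 := hm (X.indicator 1) (Y.indicator 1)
        simp only [Set.mem_ofPred_eq] at hX hY ⊢
        rw [this, hX, hY, one_mul] at h2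
        exact h2 }
  have hF : ∀ X : Set P, X ∈ F ↔ φ (X.indicator 1) = 1 := fun X => Iff.rfl
  have hFc : ∀ X : Set P, Xᶜ ∉ F ↔ X ∈ F := by
    intro X
    rw [hF, hF]
    have := hc X
    rcases hz X with h | h <;> rw [h] at this ⊢ <;> simp_all
  refine ⟨Ultrafilter.ofComplNotMemIff F hFc, fun a => ?_⟩
  change {q | a q = φ a} ∈ F
  rw [← hFc, hF]
  intro h
  have e : ({q | a q = φ a}ᶜ : Set P).indicator (1 : P → R)
      = (fun q => (a q - φ a)⁻¹) * (a - φ a • 1) := by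
    ext q
    by_cases hq : a q = φ a
    · simp [hq]
    · have : a q - φ a ≠ 0 := sub_ne_zero.2 hq
      simp [hq, this]
  rw [e, hm, map_sub, map_smul, h1] at h
  simp at h

open Classical in
theorem aux_closed {R : Type u} [Field R] {P : Type v} (U : Ultrafilter P) (φ : (P → R) → R)
    (h : ∀ a : P → R, {q | a q = φ a} ∈ U) : UFClosedUnderInter R U := by
  intro S hS hSU
  by_contra hn
  obtain ⟨f⟩ := Cardinal.lift_mk_le'.1 hS
  let a : P → R := fun p => if hp : ∃ s : S, p ∉ s.1 then f hp.choose else 0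
  have hn' := Ultrafilter.compl_mem_iff_notMem.2 hn
  have hI := Filter.inter_mem (h a) hn'
  have key : ∀ q ∈ {q | a q = φ a} ∩ (⋂₀ S)ᶜ, ∃ s : S, q ∉ s.1 ∧ f s = φ a := by
    rintro q ⟨hq, hq'⟩
    have hp : ∃ s : S, q ∉ s.1 := by
      simpa using hq'
    refine ⟨hp.choose, hp.choose_spec, ?_⟩
    rw [← hq]
    simp only [a, dif_pos hp]
  obtain ⟨p, hp⟩ := U.nonempty_of_mem hI
  obtain ⟨s, -, hs⟩ := key p hp
  obtain ⟨q, hq, hqs⟩ := U.nonempty_of_mem (Filter.inter_mem hI (hSU s.1 s.2))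
  obtain ⟨t, ht, hts⟩ := key q hq
  have : t = s := f.injective (hts.trans hs.symm)
  exact ht (this ▸ hqs)

theorem aux_lim {R : Type u} {P : Type v} (U : Ultrafilter P)
    (hU : UFClosedUnderInter R U) (a : P → R) : ∃ r, {q | a q = r} ∈ U := by
  by_contra! hn
  have := hU (Set.range fun r : R => {q | a q = r}ᶜ) Cardinal.mk_range_le_lift (by
    rintro _ ⟨r, rfl⟩
    exact Ultrafilter.compl_mem_iff_notMem.2 (hn r))
  obtain ⟨q, hq⟩ := U.nonempty_of_mem this
  exact hq _ ⟨a q, rfl⟩ rfl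

/-- For a field `R`, every `R`-algebra endomorphism (linear multiplicative
map, not necessarily unital) of `Π = ∏_{x ∈ P} R` is induced iff `P` carries no
non-principal ultrafilter closed under intersections of families of at most `|R|` of its
members. -/
theorem stmt15 {R : Type u} [Field R] {P : Type v} :
    (∀ η : (P → R) →ₗ[R] (P → R), (∀ a b : P → R, η (a * b) = η a * η b) →
        InducedEndo ⇑η) ↔
      ¬∃ U : Ultrafilter P,
        (¬∃ p : P, ∀ X : Set P, X ∈ U ↔ p ∈ X) ∧ UFClosedUnderInter R U := by
  constructor
  · rintro H ⟨U, hnp, hU⟩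
    choose φ hφ using aux_lim (R := R) U hU
    have huniq : ∀ (a : P → R) (r : R), {q | a q = r} ∈ U → φ a = r := by
      intro a r hr
      obtain ⟨q, h1, h2⟩ := U.nonempty_of_mem (Filter.inter_mem (hφ a) hr)
      exact h1.symm.trans h2
    obtain ⟨A, -, hA⟩ := H
      { toFun := fun a _ => φ a
        map_add' := by
          intro a b
          ext _
          apply huniq
          filter_upwards [hφ a, hφ b] with q h1 h2
          simp_all
        map_smul' := by
          intro c a
          ext _
          apply huniq
          filter_upwards [hφ a] with q h1
          simp_all } (by
      intro a b
      ext _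
      apply huniq
      filter_upwards [hφ a, hφ b] with q h1 h2
      simp_all)
    obtain ⟨y, -⟩ := U.nonempty_of_mem Filter.univ_mem
    by_cases hy : y ∈ ⋃ x, A x
    · obtain ⟨x, hx⟩ := Set.mem_iUnion.1 hy
      have hx' : ∀ a : P → R, φ a = a x := fun a => (hA a).1 x y hx
      refine hnp ⟨x, fun X => ?_⟩
      have h1 := hφ (X.indicator 1)
      rw [hx'] at h1
      by_cases hX : x ∈ X
      · refine iff_of_true (Filter.mem_of_superset h1 ?_) hX
        intro q hq
        by_contra hqX
        simp [hX, hqX] at hq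
      · refine iff_of_false (fun h => ?_) hX
        obtain ⟨q, h2, h3⟩ := U.nonempty_of_mem (Filter.inter_mem h1 h)
        simp [hX, h3] at h2
    · have h0 : φ 1 = 0 := (hA 1).2 y hy
      have h1 : φ 1 = 1 := huniq 1 1 (Filter.mem_of_superset Filter.univ_mem fun q _ => rfl)
      exact one_ne_zero (h1.symm.trans h0)
  · intro H η hη
    classical
    refine ⟨fun x => {y | ∀ a, η a y = a x}, ?_, fun a => ⟨fun x y hy => hy a, ?_⟩⟩
    · intro x x' hne
      refine Set.disjoint_left.2 fun y h1 h2 => ?_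
      have := (h1 (Pi.single x 1)).symm.trans (h2 (Pi.single x 1))
      simp [hne.symm] at this
    · intro y hy
      by_contra h0
      have h1 : η 1 y = 1 := by
        have := congrFun (hη 1 a) y
        rw [one_mul, Pi.mul_apply] at this
        exact mul_right_cancel₀ h0 (by rw [← this, one_mul])
      obtain ⟨U, hU⟩ := aux_char ((LinearMap.proj y).comp η : (P → R) →ₗ[R] R)
        (fun a b => congrFun (hη a b) y) h1
      refine H ⟨U, ?_, aux_closed U _ hU⟩
      rintro ⟨p, hp⟩
      refine hy (Set.mem_iUnion.2 ⟨p, fun b => ?_⟩)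
      exact ((hp _).1 (hU b)).symm
end
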